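/- arXiv:1212.1870 — 2 statements merged into one kernel-verified Lean document; each statement's English description precedes it below -/
import Mathlib

section
/- Let f : ℂ → ℂ be an entire function satisfying the quasi-periodicity equation f(z+m) = e^{2πiαm} e^{ν(z+m/2)m} f(z) for all z ∈ ℂ, m ∈ ℤ, with ∫_S |f(z)|² e^{−ν|z|²} dm(z) < ∞. Then for every z ∈ ℂ, f(z) = ∫_S K(z,w) f(w) e^{−ν|w|²} dm(w), where the reproducing kernel is K(z,w) = (2ν/π)^{1/2} e^{(ν/2)(z² + conj(w)²)} θ_{α,0}(z − conj(w) | 2πi/ν). -/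
open Complex MeasureTheory ENNReal

/-- The Riemann theta function with characteristic `[α, β]`:
`θ_{α,β}(z|τ) = Σ_{n∈ℤ} e^{πi(n+α)²τ + 2πi(n+α)(z+β)}`. -/
noncomputable def riemannTheta (α β : ℝ) (z τ : ℂ) : ℂ :=
  ∑' n : ℤ, Complex.exp (Real.pi * Complex.I * ((n : ℂ) + α) ^ 2 * τ +
    2 * Real.pi * Complex.I * ((n : ℂ) + α) * (z + β))

/-- In real coordinates, Lebesgue measure on the strip `0 ≤ Re z ≤ 1` is a product measure. -/
lemma measurePreserving_strip :
    MeasurePreserving Complex.measurableEquivRealProd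
      (volume.restrict {w : ℂ | w.re ∈ Set.Icc (0 : ℝ) 1})
      ((volume.restrict (Set.Icc (0 : ℝ) 1)).prod volume) := by
  have h := Complex.volume_preserving_equiv_real_prod.restrict_preimage
    (measurableSet_Icc (a := (0 : ℝ)) (b := 1) |>.prod (MeasurableSet.univ (α := ℝ)))
  have hS : Complex.measurableEquivRealProd ⁻¹' (Set.Icc (0 : ℝ) 1 ×ˢ Set.univ) =
      {w : ℂ | w.re ∈ Set.Icc (0 : ℝ) 1} := by
    ext w; simp
  rw [hS, Measure.volume_eq_prod, ← Measure.prod_restrict, Measure.restrict_univ] at h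
  exact h

/-- Fubini's theorem on the strip. -/
lemma integral_strip {H : ℂ → ℂ}
    (hH : IntegrableOn H {w : ℂ | w.re ∈ Set.Icc (0 : ℝ) 1}) :
    ∫ w in {w : ℂ | w.re ∈ Set.Icc (0 : ℝ) 1}, H w =
      ∫ y : ℝ, ∫ x in (0 : ℝ)..1, H (x + y * I) := by
  have hc : H = (fun p : ℝ × ℝ => H (p.1 + p.2 * I)) ∘ Complex.measurableEquivRealProd := by
    ext w; simp
  have hemb := Complex.measurableEquivRealProd.measurableEmbedding
  have hi : Integrable (fun p : ℝ × ℝ => H (p.1 + p.2 * I))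
      ((volume.restrict (Set.Icc (0 : ℝ) 1)).prod volume) := by
    rw [← measurePreserving_strip.integrable_comp_emb hemb, ← hc]
    exact hH
  have h := measurePreserving_strip.integral_comp hemb (fun p : ℝ × ℝ => H (p.1 + p.2 * I))
  rw [integral_prod_symm _ hi] at h
  simpa [intervalIntegral.integral_of_le, integral_Icc_eq_integral_Ioc] using h

lemma integrableOn_strip_comp_im {h : ℝ → ℝ} (hh : Integrable h) :
    IntegrableOn (fun w : ℂ => h w.im) {w : ℂ | w.re ∈ Set.Icc (0 : ℝ) 1} :=
  (measurePreserving_strip.integrable_comp_emb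
    Complex.measurableEquivRealProd.measurableEmbedding).2
    (hh.comp_snd (volume.restrict (Set.Icc (0 : ℝ) 1)))

lemma integral_strip_comp_im (h : ℝ → ℝ) :
    ∫ w in {w : ℂ | w.re ∈ Set.Icc (0 : ℝ) 1}, h w.im = ∫ y, h y := by
  have := measurePreserving_strip.integral_comp
    Complex.measurableEquivRealProd.measurableEmbedding (fun p : ℝ × ℝ => h p.2)
  rw [integral_fun_snd] at this
  simpa using this

lemma exp_neg_mul_sq_add_mul {b : ℝ} (hb : 0 < b) (c y : ℝ) :
    Real.exp (-b * y ^ 2 + c * y) =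
      Real.exp (c ^ 2 / (4 * b)) * Real.exp (-b * (y - c / (2 * b)) ^ 2) := by
  rw [← Real.exp_add]
  congr 1
  field_simp
  ring

lemma integrable_exp_neg_mul_sq_add_mul {b : ℝ} (hb : 0 < b) (c : ℝ) :
    Integrable fun y : ℝ => Real.exp (-b * y ^ 2 + c * y) := by
  simp_rw [exp_neg_mul_sq_add_mul hb]
  exact ((integrable_exp_neg_mul_sq hb).comp_sub_right _).const_mul _

lemma integral_exp_neg_mul_sq_add_mul {b : ℝ} (hb : 0 < b) (c : ℝ) :
    ∫ y : ℝ, Real.exp (-b * y ^ 2 + c * y) =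
      √(Real.pi / b) * Real.exp (c ^ 2 / (4 * b)) := by
  simp_rw [exp_neg_mul_sq_add_mul hb]
  rw [integral_const_mul, integral_sub_right_eq_self (fun y => Real.exp (-b * y ^ 2)),
    integral_gaussian, mul_comm]

/-- The integral of a `1`-periodic entire function over a horizontal period is independent of the
height of the segment. -/
lemma integral_period_eq {φ : ℂ → ℂ} (hφ : Differentiable ℂ φ) (hp : Function.Periodic φ 1)
    (y : ℝ) : ∫ x in (0 : ℝ)..1, φ (x + y * I) = ∫ x in (0 : ℝ)..1, φ x := by
  have h := Complex.integral_boundary_rect_eq_zero_of_differentiableOn φ 0 (1 + y * I)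
    hφ.differentiableOn
  have hper : ∀ t : ℝ, φ (1 + t * I) = φ (t * I) := fun t => by rw [add_comm, hp]
  simp only [zero_re, zero_im, add_re, one_re, mul_re, ofReal_re, I_re, mul_zero, ofReal_im, I_im,
    mul_one, sub_self, add_zero, Complex.ofReal_zero, zero_mul, add_im, one_im, mul_im, zero_add,
    Complex.ofReal_one, hper] at h
  rw [add_sub_cancel_right, sub_eq_zero] at h
  exact h.symm

/-- An entire `1`-periodic function is the sum of its Fourier series as soon as the latter
converges absolutely. -/
lemma hasSum_fourier_of_periodic {φ : ℂ → ℂ} (hφ : Differentiable ℂ φ)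
    (hp : Function.Periodic φ 1) (z : ℂ)
    (hs : Summable fun n : ℤ => Complex.exp (2 * Real.pi * I * n * z) *
      ∫ x in (0 : ℝ)..1, Complex.exp (-(2 * Real.pi * I * n * x)) * φ x) :
    HasSum (fun n : ℤ => Complex.exp (2 * Real.pi * I * n * z) *
      ∫ x in (0 : ℝ)..1, Complex.exp (-(2 * Real.pi * I * n * x)) * φ x) (φ z) := by
  have : Fact ((0 : ℝ) < 1) := ⟨one_pos⟩
  have hpG : Function.Periodic (fun x : ℝ => φ (x + z)) 1 := fun x => by
    have h := hp (x + z)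
    push_cast
    rw [← h]
    congr 1
    ring
  let G : C(AddCircle (1 : ℝ), ℂ) := ⟨hpG.lift, by
    refine continuous_coinduced_dom.2 ?_
    exact hφ.continuous.comp (by fun_prop)⟩
  have hcoeff (n : ℤ) : fourierCoeff G n = Complex.exp (2 * Real.pi * I * n * z) *
      ∫ x in (0 : ℝ)..1, Complex.exp (-(2 * Real.pi * I * n * x)) * φ x := by
    let ψ : ℂ → ℂ := fun w => Complex.exp (-(2 * Real.pi * I * n * w)) * φ w
    have hψ : Differentiable ℂ ψ := by fun_prop
    have hψp : Function.Periodic ψ 1 := fun w => by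
      have : -(2 * Real.pi * I * n * (w + 1)) =
          -(2 * Real.pi * I * n * w) - n * (2 * Real.pi * I) := by ring
      simp only [ψ, hp w, this, Complex.exp_periodic.sub_int_mul_eq]
    have hG (x : ℝ) : fourier (-n) (x : AddCircle (1 : ℝ)) • G x =
        Complex.exp (2 * Real.pi * I * n * z) * ψ ((x + z.re : ℝ) + z.im * I) := by
      have hGx : G x = φ (x + z) := rfl
      have hz : ((x + z.re : ℝ) : ℂ) + z.im * I = x + z := by
        conv_rhs => rw [← Complex.re_add_im z]
        push_cast
        ring
      rw [hGx, hz, fourier_coe_apply, smul_eq_mul]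
      simp only [ψ]
      rw [← mul_assoc, ← Complex.exp_add]
      congr 2
      push_cast
      ring
    rw [fourierCoeff_eq_intervalIntegral _ n 0]
    simp_rw [hG]
    rw [intervalIntegral.integral_const_mul,
      intervalIntegral.integral_comp_add_right (fun x : ℝ => ψ (x + z.im * I))]
    have hper : Function.Periodic (fun x : ℝ => ψ (x + z.im * I)) 1 := fun x => by
      have h := hψp (x + z.im * I)
      push_cast
      rw [← h]
      congr 1
      ring
    have hshift := hper.intervalIntegral_add_eq (0 + z.re) 0
    rw [show (0 : ℝ) + 1 + z.re = 0 + z.re + 1 by ring, hshift, zero_add,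
      integral_period_eq hψ hψp]
    simp [ψ]
  have hsum := has_pointwise_sum_fourier_series_of_summable (f := G)
    (by rw [funext hcoeff]; exact hs) ((0 : ℝ) : AddCircle (1 : ℝ))
  have hG0 : G ((0 : ℝ) : AddCircle (1 : ℝ)) = φ z := by
    change φ ((0 : ℝ) + z) = φ z
    simp
  rw [hG0] at hsum
  simpa [hcoeff] using hsum

/-- Absolute convergence of shifted Gaussian sums over `ℤ`. -/
lemma summable_exp_neg_mul_sq_add_mul {a : ℝ} (ha : 0 < a) (α b : ℝ) :
    Summable fun n : ℤ => Real.exp (-a * (n + α) ^ 2 + b * (n + α)) := by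
  have h := ((summable_jacobiTheta₂_term_iff (((2 * a * α - b) / (2 * Real.pi) : ℝ) * I)
    ((a / Real.pi : ℝ) * I)).2 (by simp; positivity)).norm.mul_left
      (Real.exp (-a * α ^ 2 + b * α))
  refine h.congr fun n => ?_
  rw [jacobiTheta₂_term, Complex.norm_exp, ← Real.exp_add]
  congr 1
  have : (2 * Real.pi * I * n * (((2 * a * α - b) / (2 * Real.pi) : ℝ) * I) +
      Real.pi * I * n ^ 2 * ((a / Real.pi : ℝ) * I) : ℂ) =
      ((-(2 * a * α - b) * n - a * n ^ 2 : ℝ) : ℂ) := by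
    push_cast
    have : (Real.pi : ℂ) ≠ 0 := by exact_mod_cast Real.pi_ne_zero
    field_simp
    ring_nf
    simp only [I_sq]
    ring
  rw [this, ofReal_re]
  ring

/-- The `n`-th term of the series `e^{-(ν/2) z²} K(z,w) e^{-ν|w|²}`, up to the constant
`(2ν/π)^{1/2}`. -/
noncomputable def kernelTerm (α ν : ℝ) (z w : ℂ) (n : ℤ) : ℂ :=
  Complex.exp (-(2 * Real.pi ^ 2 / ν) * (n + α) ^ 2 +
    2 * Real.pi * I * (n + α) * (z - (starRingEnd ℂ) w) +
    ν / 2 * (starRingEnd ℂ) w ^ 2 - ν * Complex.normSq w)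

lemma kernel_eq_tsum (α ν : ℝ) (hν : 0 < ν) (z w u : ℂ) :
    (((2 * ν / Real.pi) ^ ((1 : ℝ) / 2) : ℝ) : ℂ) *
          Complex.exp (ν / 2 * (z ^ 2 + (starRingEnd ℂ) w ^ 2)) *
          riemannTheta α 0 (z - (starRingEnd ℂ) w) (2 * Real.pi * Complex.I / ν) *
          u * Real.exp (-ν * Complex.normSq w) =
      (((2 * ν / Real.pi) ^ ((1 : ℝ) / 2) : ℝ) : ℂ) * Complex.exp (ν / 2 * z ^ 2) *
        ∑' n : ℤ, kernelTerm α ν z w n * u := by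
  have hν' : (ν : ℂ) ≠ 0 := by exact_mod_cast hν.ne'
  have hterm (n : ℤ) : kernelTerm α ν z w n =
      Complex.exp (Real.pi * Complex.I * ((n : ℂ) + α) ^ 2 * (2 * Real.pi * Complex.I / ν) +
        2 * Real.pi * Complex.I * ((n : ℂ) + α) * (z - (starRingEnd ℂ) w + (0 : ℝ))) *
      Complex.exp (ν / 2 * (starRingEnd ℂ) w ^ 2 - ν * Complex.normSq w) := by
    rw [kernelTerm, ← Complex.exp_add]
    congr 1
    push_cast
    field_simp
    ring_nf
    simp only [I_sq]
    ring
  rw [tsum_mul_right]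
  simp_rw [hterm]
  rw [tsum_mul_right, ← riemannTheta, mul_add, Complex.exp_add,
    sub_eq_add_neg (ν / 2 * (starRingEnd ℂ) w ^ 2), Complex.exp_add]
  push_cast
  rw [neg_mul]
  ring

/-- On a horizontal line the terms of the kernel are, up to a Gaussian factor, Fourier
characters. -/
lemma kernelTerm_eq (α ν : ℝ) (z w : ℂ) (n : ℤ) :
    kernelTerm α ν z w n =
      Complex.exp (-(2 * Real.pi ^ 2 / ν) * (n + α) ^ 2 + 2 * Real.pi * I * (n + α) * z) *
      (Real.exp (-(2 * ν) * w.im ^ 2 + -(4 * Real.pi * (n + α)) * w.im) : ℝ) *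
      (Complex.exp (-(2 * Real.pi * I * n * w)) *
        Complex.exp (-(ν / 2 * w ^ 2 + 2 * Real.pi * I * α * w))) := by
  obtain ⟨x, y⟩ := w
  have hw : (⟨x, y⟩ : ℂ) = x + y * I := by apply Complex.ext <;> simp
  rw [kernelTerm, Complex.ofReal_exp, ← Complex.exp_add, ← Complex.exp_add, ← Complex.exp_add,
    Complex.normSq_mk, hw]
  congr 1
  simp
  ring_nf
  simp only [I_sq]
  ring

lemma norm_kernelTerm (α ν : ℝ) (z w : ℂ) (n : ℤ) :
    ‖kernelTerm α ν z w n‖ =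
      Real.exp (-(Real.pi ^ 2 / ν) * (n + α) ^ 2 + -(2 * Real.pi * z.im) * (n + α)) *
      (Real.exp (-(Real.pi ^ 2 / ν) * (n + α) ^ 2 - ν * w.im ^ 2 -
        2 * Real.pi * (n + α) * w.im) * Real.exp (-ν / 2 * Complex.normSq w)) := by
  obtain ⟨x, y⟩ := w
  obtain ⟨a, b⟩ := z
  have hw : (⟨x, y⟩ : ℂ) = x + y * I := by apply Complex.ext <;> simp
  have hz : (⟨a, b⟩ : ℂ) = a + b * I := by apply Complex.ext <;> simp
  have : -(2 * Real.pi ^ 2 / ν) * (n + α) ^ 2 +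
      2 * Real.pi * I * (n + α) * (⟨a, b⟩ - (starRingEnd ℂ) ⟨x, y⟩) +
      ν / 2 * (starRingEnd ℂ) ⟨x, y⟩ ^ 2 - ν * Complex.normSq ⟨x, y⟩ =
      ((-(2 * Real.pi ^ 2 / ν) * (n + α) ^ 2 - 2 * Real.pi * (n + α) * (b + y) +
        ν / 2 * (x ^ 2 - y ^ 2) - ν * (x * x + y * y) : ℝ) : ℂ) +
      ((2 * Real.pi * (n + α) * (a - x) - ν * x * y : ℝ) : ℂ) * I := by
    rw [Complex.normSq_mk, hw, hz]
    simp
    ring_nf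
    simp only [I_sq]
    ring
  rw [kernelTerm, this, Complex.norm_exp, ← Real.exp_add, ← Real.exp_add, Complex.normSq_mk]
  simp only [add_re, ofReal_re, mul_re, I_re, ofReal_im, I_im]
  ring_nf

/-- The arithmetic–geometric mean bound which separates `f` from the kernel. -/
lemma norm_kernelTerm_mul_le (α ν : ℝ) (z w u : ℂ) (n : ℤ) :
    ‖kernelTerm α ν z w n * u‖ ≤
      Real.exp (-(Real.pi ^ 2 / ν) * (n + α) ^ 2 + -(2 * Real.pi * z.im) * (n + α)) *
      (Real.exp (-(2 * Real.pi ^ 2 / ν) * (n + α) ^ 2) *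
          Real.exp (-(2 * ν) * w.im ^ 2 + -(4 * Real.pi * (n + α)) * w.im) +
        ‖u‖ ^ 2 * Real.exp (-ν * Complex.normSq w)) := by
  rw [norm_mul, norm_kernelTerm, mul_assoc, mul_assoc]
  gcongr
  set a := Real.exp (-(Real.pi ^ 2 / ν) * (n + α) ^ 2 - ν * w.im ^ 2 -
    2 * Real.pi * (n + α) * w.im) with ha
  set b := Real.exp (-ν / 2 * Complex.normSq w) with hb
  have ha2 : Real.exp (-(2 * Real.pi ^ 2 / ν) * (n + α) ^ 2) *
      Real.exp (-(2 * ν) * w.im ^ 2 + -(4 * Real.pi * (n + α)) * w.im) = a ^ 2 := by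
    rw [ha, ← Real.exp_add, ← Real.exp_nat_mul]
    congr 1
    push_cast
    ring
  have hb2 : Real.exp (-ν * Complex.normSq w) = b ^ 2 := by
    rw [hb, ← Real.exp_nat_mul]
    congr 1
    push_cast
    ring
  rw [ha2, hb2]
  nlinarith [sq_nonneg (a - b * ‖u‖), sq_nonneg a, sq_nonneg (b * ‖u‖)]

lemma continuous_kernelTerm (α ν : ℝ) (z : ℂ) (n : ℤ) :
    Continuous fun w => kernelTerm α ν z w n := by
  unfold kernelTerm
  have := Complex.continuous_normSq
  fun_prop

lemma integrableOn_norm_sq {ν : ℝ} {f : ℂ → ℂ} (hf : Continuous f) {S : Set ℂ}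
    (hfin : (∫⁻ z in S,
        (‖f z‖₊ : ℝ≥0∞) ^ 2 * ENNReal.ofReal (Real.exp (-ν * Complex.normSq z))) ≠ ⊤) :
    IntegrableOn (fun w => ‖f w‖ ^ 2 * Real.exp (-ν * Complex.normSq w)) S := by
  have := Complex.continuous_normSq
  refine ⟨(by fun_prop : Continuous _).aestronglyMeasurable, ?_⟩
  rw [hasFiniteIntegral_iff_ofReal (Filter.Eventually.of_forall fun w => by positivity)]
  refine lt_of_eq_of_lt ?_ (lt_top_iff_ne_top.2 hfin)
  refine lintegral_congr fun w => ?_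
  rw [ENNReal.ofReal_mul (by positivity), ENNReal.ofReal_pow (norm_nonneg _), ofReal_norm]
  rfl

/-- The reproducing property: for every entire quasi-periodic `f` with finite
weighted `L²` norm on the strip `S` and every `z ∈ ℂ`,
`f(z) = ∫_S K(z,w) f(w) e^{−ν|w|²} dm(w)` where
`K(z,w) = (2ν/π)^{1/2} e^{(ν/2)(z² + conj(w)²)} θ_{α,0}(z − conj(w) | 2πi/ν)`. -/
theorem stmt_8 (α ν : ℝ) (hν : 0 < ν) (f : ℂ → ℂ) (hf : Differentiable ℂ f)
    (hqp : ∀ (z : ℂ) (m : ℤ), f (z + m) =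
        Complex.exp (2 * Real.pi * Complex.I * α * m) *
          Complex.exp (ν * (z + m / 2) * m) * f z)
    (hfin : (∫⁻ z in {z : ℂ | z.re ∈ Set.Icc (0 : ℝ) 1},
        (‖f z‖₊ : ℝ≥0∞) ^ 2 * ENNReal.ofReal (Real.exp (-ν * Complex.normSq z))) ≠ ⊤) :
    ∀ z : ℂ, f z =
      ∫ w in {w : ℂ | w.re ∈ Set.Icc (0 : ℝ) 1},
        (((2 * ν / Real.pi) ^ ((1 : ℝ) / 2) : ℝ) : ℂ) *
          Complex.exp (ν / 2 * (z ^ 2 + (starRingEnd ℂ) w ^ 2)) *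
          riemannTheta α 0 (z - (starRingEnd ℂ) w) (2 * Real.pi * Complex.I / ν) *
          f w * Real.exp (-ν * Complex.normSq w) := by
  intro z
  have hfc := hf.continuous
  let φ : ℂ → ℂ := fun w => Complex.exp (-(ν / 2 * w ^ 2 + 2 * Real.pi * I * α * w)) * f w
  have hφ : Differentiable ℂ φ := by fun_prop
  have hφp : Function.Periodic φ 1 := fun w => by
    have h := hqp w 1
    simp only [Int.cast_one, mul_one] at h
    simp only [φ]
    rw [h, ← mul_assoc, ← Complex.exp_add, ← Complex.exp_add]
    congr 2
    ring
  have hB := integrableOn_norm_sq hfc hfin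
  have hgauss (n : ℤ) := integrable_exp_neg_mul_sq_add_mul (b := 2 * ν) (by positivity)
    (-(4 * Real.pi * (n + α)))
  have hgauss_val (n : ℤ) : ∫ y : ℝ,
      Real.exp (-(2 * ν) * y ^ 2 + -(4 * Real.pi * (n + α)) * y) =
      √(Real.pi / (2 * ν)) * Real.exp (2 * Real.pi ^ 2 / ν * (n + α) ^ 2) := by
    rw [integral_exp_neg_mul_sq_add_mul (by positivity)]
    congr 2
    field_simp
    ring
  have hmaj (n : ℤ) := ((integrableOn_strip_comp_im (hgauss n)).const_mul
    (Real.exp (-(2 * Real.pi ^ 2 / ν) * (n + α) ^ 2))).add hB |>.const_mul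
    (Real.exp (-(Real.pi ^ 2 / ν) * (n + α) ^ 2 + -(2 * Real.pi * z.im) * (n + α)))
  have hint (n : ℤ) : IntegrableOn (fun w => kernelTerm α ν z w n * f w)
      {w : ℂ | w.re ∈ Set.Icc (0 : ℝ) 1} :=
    (hmaj n).mono' ((continuous_kernelTerm α ν z n).mul hfc).aestronglyMeasurable
      (Filter.Eventually.of_forall fun w => norm_kernelTerm_mul_le α ν z w (f w) n)
  have hsum : Summable fun n : ℤ => ∫ w in {w : ℂ | w.re ∈ Set.Icc (0 : ℝ) 1},
      ‖kernelTerm α ν z w n * f w‖ := by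
    refine Summable.of_nonneg_of_le (fun n => integral_nonneg fun w => norm_nonneg _)
      (fun n => integral_mono (hint n).norm (hmaj n)
        fun w => norm_kernelTerm_mul_le α ν z w (f w) n) ?_
    refine ((summable_exp_neg_mul_sq_add_mul (a := Real.pi ^ 2 / ν) (by positivity) α
      (-(2 * Real.pi * z.im))).mul_right (√(Real.pi / (2 * ν)) +
        ∫ w in {w : ℂ | w.re ∈ Set.Icc (0 : ℝ) 1},
          ‖f w‖ ^ 2 * Real.exp (-ν * Complex.normSq w))).congr fun n => ?_
    rw [integral_const_mul]
    congr 1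
    refine Eq.trans ?_ (integral_add ((integrableOn_strip_comp_im (hgauss n)).const_mul _) hB).symm
    rw [integral_const_mul, integral_strip_comp_im
      (fun y => Real.exp (-(2 * ν) * y ^ 2 + -(4 * Real.pi * (n + α)) * y)), hgauss_val,
      mul_left_comm, ← Real.exp_add]
    simp
  have hterm (n : ℤ) :
      ∫ w in {w : ℂ | w.re ∈ Set.Icc (0 : ℝ) 1}, kernelTerm α ν z w n * f w =
      (√(Real.pi / (2 * ν)) * Complex.exp (2 * Real.pi * I * α * z)) *
        (Complex.exp (2 * Real.pi * I * n * z) *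
        ∫ x in (0 : ℝ)..1, Complex.exp (-(2 * Real.pi * I * n * x)) * φ x) := by
    let ψ : ℂ → ℂ := fun w => Complex.exp (-(2 * Real.pi * I * n * w)) * φ w
    have hψ : Differentiable ℂ ψ := by fun_prop
    have hψp : Function.Periodic ψ 1 := fun w => by
      have : -(2 * Real.pi * I * n * (w + 1)) =
          -(2 * Real.pi * I * n * w) - n * (2 * Real.pi * I) := by ring
      simp only [ψ, hφp w, this, Complex.exp_periodic.sub_int_mul_eq]
    have hline (x y : ℝ) : kernelTerm α ν z (x + y * I) n * f (x + y * I) =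
        Complex.exp (-(2 * Real.pi ^ 2 / ν) * (n + α) ^ 2 + 2 * Real.pi * I * (n + α) * z) *
        (Real.exp (-(2 * ν) * y ^ 2 + -(4 * Real.pi * (n + α)) * y) : ℝ) *
        ψ (x + y * I) := by
      rw [kernelTerm_eq]
      simp [ψ, φ, mul_assoc]
    rw [integral_strip (hint n)]
    simp_rw [hline, intervalIntegral.integral_const_mul, integral_period_eq hψ hψp]
    rw [integral_mul_const, integral_const_mul, integral_complex_ofReal, hgauss_val, ← mul_assoc]
    simp only [ψ]
    congr 1
    rw [Complex.ofReal_mul, Complex.ofReal_exp, mul_left_comm, mul_assoc (√(Real.pi / (2 * ν)) : ℂ),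
      ← Complex.exp_add, ← Complex.exp_add]
    congr 2
    push_cast
    ring
  have hHas := hasSum_integral_of_summable_integral_norm hint hsum
  simp_rw [hterm] at hHas
  have hc : (√(Real.pi / (2 * ν)) * Complex.exp (2 * Real.pi * I * α * z) : ℂ) ≠ 0 := by
    have : √(Real.pi / (2 * ν)) ≠ 0 := by positivity
    exact mul_ne_zero (by exact_mod_cast this) (Complex.exp_ne_zero _)
  have hval := hHas.unique ((hasSum_fourier_of_periodic hφ hφp z
    ((summable_mul_left_iff hc).1 hHas.summable)).mul_left _)
  simp_rw [kernel_eq_tsum α ν hν]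
  rw [integral_const_mul, hval]
  have hone : (2 * ν / Real.pi) ^ ((1 : ℝ) / 2) * √(Real.pi / (2 * ν)) = 1 := by
    rw [← Real.sqrt_eq_rpow, ← Real.sqrt_mul (by positivity)]
    have := Real.pi_ne_zero
    field_simp
    simp
  have hexp : Complex.exp (ν / 2 * z ^ 2) * (Complex.exp (2 * Real.pi * I * α * z) *
      Complex.exp (-(ν / 2 * z ^ 2 + 2 * Real.pi * I * α * z))) = 1 := by
    rw [← Complex.exp_add, ← Complex.exp_add, ← Complex.exp_zero]
    congr 1
    ring
  have hone' : (((2 * ν / Real.pi) ^ ((1 : ℝ) / 2) : ℝ) : ℂ) * (√(Real.pi / (2 * ν)) : ℝ) = 1 := by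
    exact_mod_cast hone
  simp only [φ]
  linear_combination (-f z) * hone' - (f z * (((2 * ν / Real.pi) ^ ((1 : ℝ) / 2) : ℝ) : ℂ) *
    (√(Real.pi / (2 * ν)) : ℝ)) * hexp
end

section
/- Let f : ℂ → ℂ be a measurable function satisfying f(z+m) = e^{2πiαm} e^{ν(z+m/2)m} f(z) for almost every z ∈ ℂ and every m ∈ ℤ, with ∫_S |f(z)|² e^{−ν|z|²} dm(z) < ∞. If ∫_S f(z) conj(ψ_{m,n}(z)) e^{−ν|z|²} dm(z) = 0 for every integer m ≥ 0 and every n ∈ ℤ, then f = 0 almost everywhere; that is, the orthonormal system (ψ_{m,n})_{m≥0, n∈ℤ} is complete in this space. -/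
open Complex MeasureTheory ENNReal

/-- The physicists' Hermite polynomials, defined by `H₀ = 1` and
`H_{m+1}(x) = 2x H_m(x) − H_m'(x)`. -/
noncomputable def physHermite : ℕ → Polynomial ℝ
  | 0 => 1
  | m + 1 => 2 * Polynomial.X * physHermite m - Polynomial.derivative (physHermite m)

/-- `ψ_{m,n}(z) = (2^m m!)^{−1/2} (2ν/π)^{1/4} e^{−(π²/ν)(n+α)²}
e^{(ν/2)z² + 2πi(α+n)z} H_m(√(2ν) y + √(2/ν) π(n+α))`, where `z = x + iy`. -/
noncomputable def psiMN (α ν : ℝ) (m : ℕ) (n : ℤ) (z : ℂ) : ℂ :=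
  ((((2 : ℝ) ^ m * Nat.factorial m) ^ (-(1 : ℝ) / 2) *
      (2 * ν / Real.pi) ^ ((1 : ℝ) / 4) *
      Real.exp (-(Real.pi ^ 2 / ν) * (n + α) ^ 2) : ℝ) : ℂ) *
    Complex.exp (ν / 2 * z ^ 2 + 2 * Real.pi * Complex.I * (α + n) * z) *
    (((physHermite m).eval
        (Real.sqrt (2 * ν) * z.im + Real.sqrt (2 / ν) * Real.pi * (n + α)) : ℝ) : ℂ)

open scoped FourierTransform ContDiff in
/-- An integrable function on `ℝ` with vanishing Fourier transform vanishes almost everywhere. -/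
theorem ae_eq_zero_of_integral_exp_mul_eq_zero {h : ℝ → ℂ} (hh : Integrable h)
    (h0 : ∀ t : ℝ, ∫ y : ℝ, Complex.exp (t * y * I) * h y = 0) : ∀ᵐ y, h y = 0 := by
  apply ae_eq_zero_of_integral_contDiff_smul_eq_zero hh.locallyIntegrable
  intro φ φ_smooth φ_cpt
  have hφ₁ : HasCompactSupport (Complex.ofRealCLM ∘ φ) := φ_cpt.comp_left rfl
  have hφ₂ : ContDiff ℝ ∞ (Complex.ofRealCLM ∘ φ) := by fun_prop
  set Φ : SchwartzMap ℝ ℂ := hφ₁.toSchwartzMap hφ₂ with hΦ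
  set Ψ : SchwartzMap ℝ ℂ := 𝓕⁻ Φ with hΨ
  have hΦΨ : 𝓕 (Ψ : ℝ → ℂ) = Φ := by
    rw [← SchwartzMap.fourier_coe, hΨ, FourierTransform.fourier_fourierInv_eq]
  have hz : 𝓕 h = 0 := by
    funext w
    rw [Real.fourier_real_eq_integral_exp_smul]
    rw [Pi.zero_apply, ← h0 (-2 * Real.pi * w)]
    refine integral_congr_ae (.of_forall fun y => ?_)
    simp only [smul_eq_mul]
    push_cast
    ring_nf
  have key := VectorFourier.integral_fourierIntegral_smul_eq_flip (μ := volume) (ν := volume)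
    (L := innerₗ ℝ) (e := Real.fourierChar) Real.continuous_fourierChar continuous_inner
    Ψ.integrable hh
  rw [flip_innerₗ] at key
  change ∫ ξ, (𝓕 (Ψ : ℝ → ℂ)) ξ • h ξ = ∫ x, Ψ x • (𝓕 h) x at key
  rw [hΦΨ, hz] at key
  simpa [hΦ] using key

/-- A square integrable function on `(0, 1]` all of whose Fourier coefficients vanish is zero
almost everywhere. -/
theorem ae_eq_zero_of_forall_fourier_integral_eq_zero {u : ℝ → ℂ}
    (hu : MemLp u 2 (volume.restrict (Set.Ioc 0 1)))
    (h0 : ∀ n : ℤ, ∫ x : ℝ in Set.Ioc 0 1,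
      Complex.exp (-(2 * Real.pi * I * n * x)) * u x = 0) :
    ∀ᵐ x ∂volume.restrict (Set.Ioc (0 : ℝ) 1), u x = 0 := by
  have hcoeff : ∀ n : ℤ, fourierCoeffOn (zero_lt_one' ℝ) u n = 0 := by
    intro n
    rw [fourierCoeffOn_eq_integral, intervalIntegral.integral_of_le zero_le_one]
    convert smul_zero _
    rw [← h0 n]
    refine integral_congr_ae (.of_forall fun x => ?_)
    simp only [smul_eq_mul, fourier_coe_apply]
    push_cast
    ring_nf
  have hsum := tsum_sq_fourierCoeffOn (zero_lt_one' ℝ) hu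
  simp only [hcoeff, norm_zero, ne_eq, OfNat.ofNat_ne_zero, not_false_eq_true, zero_pow,
    tsum_zero, sub_zero, inv_one, one_smul] at hsum
  rw [intervalIntegral.integral_of_le zero_le_one] at hsum
  have := (integral_eq_zero_iff_of_nonneg (fun x => by positivity)
    ((memLp_two_iff_integrable_sq_norm hu.1).1 hu)).1 hsum.symm
  filter_upwards [this] with x hx
  simpa using hx

section Moments

variable {Ω : Type*} [MeasurableSpace Ω] {μ : Measure Ω} {F : Ω → ℂ} {Y : Ω → ℝ}

theorem integrable_eval_mul_of_integrable_exp_mul (hY : Measurable Y)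
    (hF : ∀ C : ℝ, Integrable (fun ω => (Real.exp (C * |Y ω|) : ℂ) * F ω) μ)
    (P : Polynomial ℝ) : Integrable (fun ω => ((P.eval (Y ω) : ℝ) : ℂ) * F ω) μ := by
  have hF0 : AEStronglyMeasurable F μ := by simpa using (hF 0).1
  induction P using Polynomial.induction_on' with
  | add p q hp hq =>
    refine (hp.add hq).congr (.of_forall fun ω => ?_)
    simp [add_mul]
  | monomial n a =>
    refine ((hF 1).norm.const_mul (|a| * n.factorial)).mono' ?_ (.of_forall fun ω => ?_)
    · have : Measurable fun ω => (((Polynomial.monomial n a).eval (Y ω) : ℝ) : ℂ) := by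
        simp only [Polynomial.eval_monomial]; fun_prop
      exact this.aestronglyMeasurable.mul hF0
    · have h := Real.pow_div_factorial_le_exp |Y ω| (abs_nonneg _) n
      rw [div_le_iff₀ (by positivity)] at h
      simp only [Polynomial.eval_monomial, norm_mul, Complex.norm_real, Real.norm_eq_abs,
        abs_pow, Real.abs_exp, one_mul]
      calc |a| * |Y ω| ^ n * ‖F ω‖ ≤ |a| * (Real.exp |Y ω| * n.factorial) * ‖F ω‖ := by gcongr
        _ = _ := by ring

/-- If all moments of `Y` against `F` vanish, and `F` has all exponential moments in `Y`, then the
Laplace transform vanishes identically. -/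
theorem integral_cexp_mul_eq_zero_of_moments_eq_zero (hY : Measurable Y)
    (hF : ∀ C : ℝ, Integrable (fun ω => (Real.exp (C * |Y ω|) : ℂ) * F ω) μ)
    (h0 : ∀ k : ℕ, ∫ ω, (Y ω : ℂ) ^ k * F ω ∂μ = 0) (w : ℂ) :
    ∫ ω, Complex.exp (w * Y ω) * F ω ∂μ = 0 := by
  have hF0 : AEStronglyMeasurable F μ := by simpa using (hF 0).1
  have hs (r : ℝ) : HasSum (fun n : ℕ => r ^ n / n.factorial) (Real.exp r) := by
    rw [Real.exp_eq_exp_ℝ]; exact NormedSpace.expSeries_div_hasSum_exp r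
  have hsC (r : ℂ) : HasSum (fun n : ℕ => r ^ n / n.factorial) (Complex.exp r) := by
    rw [Complex.exp_eq_exp_ℂ]; exact NormedSpace.expSeries_div_hasSum_exp r
  have key := hasSum_integral_of_dominated_convergence (μ := μ)
    (F := fun (k : ℕ) ω => (w * Y ω) ^ k / k.factorial * F ω)
    (f := fun ω => Complex.exp (w * Y ω) * F ω)
    (fun k ω => (‖w‖ * |Y ω|) ^ k / k.factorial * ‖F ω‖) ?_ ?_ ?_ ?_ ?_
  · refine key.unique ?_
    convert hasSum_zero with k
    have := h0 k
    calc _ = ∫ ω, (w ^ k / k.factorial) * ((Y ω : ℂ) ^ k * F ω) ∂μ := by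
          refine integral_congr_ae (.of_forall fun ω => ?_)
          simp only [mul_pow]; ring
      _ = 0 := by rw [integral_const_mul, this, mul_zero]
  · intro k
    exact AEStronglyMeasurable.mul (by fun_prop) hF0
  · intro k
    refine .of_forall fun ω => ?_
    simp
  · exact .of_forall fun ω => ((hs _).mul_right _).summable
  · refine (hF ‖w‖).norm.congr (.of_forall fun ω => ?_)
    simp only [norm_mul, Complex.norm_real, Real.norm_eq_abs, Real.abs_exp]
    exact ((hs _).mul_right _).tsum_eq.symm
  · exact .of_forall fun ω => (hsC _).mul_right _

theorem derivative_physHermite_succ (m : ℕ) :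
    Polynomial.derivative (physHermite (m + 1)) = (2 * (m + 1) : ℝ) • physHermite m := by
  induction m with
  | zero => simp [physHermite, Polynomial.smul_eq_C_mul, map_ofNat Polynomial.C 2]
  | succ m ih =>
    rw [physHermite, Polynomial.derivative_sub, ih]
    simp only [Polynomial.derivative_mul, ih, Polynomial.derivative_smul,
      Polynomial.derivative_ofNat, Polynomial.derivative_X]
    rw [show physHermite (m + 1) =
      2 * Polynomial.X * physHermite m - Polynomial.derivative (physHermite m) from rfl]
    simp only [Polynomial.smul_eq_C_mul, map_mul, map_add, map_ofNat, map_one, Nat.cast_add,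
      Nat.cast_one]
    ring

theorem span_range_physHermite : Submodule.span ℝ (Set.range physHermite) = ⊤ := by
  set V := Submodule.span ℝ (Set.range physHermite)
  have hmem (m : ℕ) : physHermite m ∈ V := Submodule.subset_span ⟨m, rfl⟩
  have hder (m : ℕ) : Polynomial.derivative (physHermite m) ∈ V := by
    cases m with
    | zero => simp [physHermite]
    | succ m => rw [derivative_physHermite_succ]; exact V.smul_mem _ (hmem m)
  have hX : ∀ P ∈ V, Polynomial.X * P ∈ V := by
    intro P hP
    induction hP using Submodule.span_induction with
    | mem P hP =>
      obtain ⟨m, rfl⟩ := hP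
      have : Polynomial.X * physHermite m = (1 / 2 : ℝ) •
          (physHermite (m + 1) + Polynomial.derivative (physHermite m)) := by
        rw [physHermite, sub_add_cancel, Polynomial.smul_eq_C_mul, ← mul_assoc, ← mul_assoc,
          ← map_ofNat Polynomial.C 2, ← map_mul]
        norm_num
      rw [this]
      exact V.smul_mem _ (V.add_mem (hmem _) (hder m))
    | zero => simp
    | add P Q _ _ hP hQ => rw [mul_add]; exact V.add_mem hP hQ
    | smul a P _ hP => rw [mul_smul_comm]; exact V.smul_mem _ hP
  have hpow (k : ℕ) : (Polynomial.X : Polynomial ℝ) ^ k ∈ V := by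
    induction k with
    | zero => exact hmem 0
    | succ k ih => rw [pow_succ']; exact hX _ ih
  rw [eq_top_iff]
  intro P _
  induction P using Polynomial.induction_on' with
  | add p q hp hq => exact V.add_mem (hp trivial) (hq trivial)
  | monomial n a =>
    rw [← Polynomial.smul_X_eq_monomial]; exact V.smul_mem _ (hpow n)

/-- Orthogonality to all Hermite polynomials in `a Y + b` with `a ≠ 0` forces all moments of `Y`
to vanish. -/
theorem moments_eq_zero_of_integral_physHermite_eq_zero (hY : Measurable Y)
    (hF : ∀ C : ℝ, Integrable (fun ω => (Real.exp (C * |Y ω|) : ℂ) * F ω) μ)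
    {a b : ℝ} (ha : a ≠ 0)
    (h0 : ∀ m : ℕ, ∫ ω, (((physHermite m).eval (a * Y ω + b) : ℝ) : ℂ) * F ω ∂μ = 0) (k : ℕ) :
    ∫ ω, (Y ω : ℂ) ^ k * F ω ∂μ = 0 := by
  have hint (P : Polynomial ℝ) :
      Integrable (fun ω => ((P.eval (a * Y ω + b) : ℝ) : ℂ) * F ω) μ := by
    refine (integrable_eval_mul_of_integrable_exp_mul hY hF
      (P.comp (Polynomial.C a * Polynomial.X + Polynomial.C b))).congr (.of_forall fun ω => ?_)
    simp [Polynomial.eval_comp]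
  have hall (P : Polynomial ℝ) :
      ∫ ω, ((P.eval (a * Y ω + b) : ℝ) : ℂ) * F ω ∂μ = 0 := by
    have hP : P ∈ Submodule.span ℝ (Set.range physHermite) := by
      rw [span_range_physHermite]; trivial
    induction hP using Submodule.span_induction with
    | mem P hP => obtain ⟨m, rfl⟩ := hP; exact h0 m
    | zero => simp
    | add P Q _ _ hP hQ =>
      simp only [Polynomial.eval_add, Complex.ofReal_add, add_mul]
      rw [integral_add (hint P) (hint Q), hP, hQ, add_zero]
    | smul c P _ hP =>
      simp only [Polynomial.eval_smul, smul_eq_mul, Complex.ofReal_mul, mul_assoc]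
      rw [integral_const_mul, hP, mul_zero]
  rw [← hall ((Polynomial.C a⁻¹ * (Polynomial.X - Polynomial.C b)) ^ k)]
  refine integral_congr_ae (.of_forall fun ω => ?_)
  simp [ha]

end Moments

theorem memLp_two_exp_mul_abs_sub_mul_sq {ν : ℝ} (hν : 0 < ν) (c : ℝ) :
    MemLp (fun y : ℝ => Real.exp (c * |y| - ν * y ^ 2)) 2 := by
  rw [memLp_two_iff_integrable_sq (by fun_prop)]
  refine ((integrable_exp_neg_mul_sq hν).const_mul (Real.exp (c ^ 2 / ν))).mono'
    (by fun_prop) (.of_forall fun y => ?_)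
  rw [Real.norm_of_nonneg (by positivity), ← Real.exp_nat_mul, ← Real.exp_add]
  gcongr
  have h : 0 ≤ (c - ν * |y|) ^ 2 / ν := by positivity
  have h' : (c - ν * |y|) ^ 2 / ν = c ^ 2 / ν - 2 * c * |y| + ν * y ^ 2 := by
    rw [← sq_abs y]
    field_simp
    ring
  push_cast
  linarith

/-- Completeness of the functions `e^{2πinx} e^{-νy² - β_n y} H_m(a y + b_n)` in `L²` of the strip
`(0, 1] × ℝ`. -/
theorem ae_eq_zero_of_integral_strip_eq_zero {ν : ℝ} (hν : 0 < ν) {g : ℝ × ℝ → ℂ}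
    (hg : Measurable g) (hg2 : MemLp g 2 ((volume.restrict (Set.Ioc 0 1)).prod volume))
    {a : ℝ} (ha : a ≠ 0) {b β : ℤ → ℝ}
    (h0 : ∀ (m : ℕ) (n : ℤ), ∫ p : ℝ × ℝ, (((physHermite m).eval (a * p.2 + b n) : ℝ) : ℂ) *
      (Complex.exp (-(2 * Real.pi * I * n * p.1)) *
        (Real.exp (-ν * p.2 ^ 2 - β n * p.2) * g p))
      ∂((volume.restrict (Set.Ioc 0 1)).prod volume) = 0) :
    ∀ᵐ p ∂((volume.restrict (Set.Ioc 0 1)).prod volume), g p = 0 := by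
  set μ : Measure (ℝ × ℝ) := (volume.restrict (Set.Ioc 0 1)).prod volume with hμ
  have hexp (c : ℝ) : Integrable (fun p : ℝ × ℝ => Real.exp (c * |p.2| - ν * p.2 ^ 2) * ‖g p‖) μ :=
    ((memLp_two_exp_mul_abs_sub_mul_sq hν c).comp_snd _).integrable_mul hg2.norm
  have hnorm (n : ℤ) (x : ℝ) : ‖Complex.exp (-(2 * Real.pi * I * n * x))‖ = 1 := by
    rw [show -(2 * Real.pi * I * n * x : ℂ) = ((-(2 * Real.pi * n * x) : ℝ) : ℂ) * I by
      push_cast; ring]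
    exact Complex.norm_exp_ofReal_mul_I _
  have hF (n : ℤ) (C : ℝ) : Integrable (fun p : ℝ × ℝ => (Real.exp (C * |p.2|) : ℂ) *
      (Complex.exp (-(2 * Real.pi * I * n * p.1)) *
        (Real.exp (-ν * p.2 ^ 2 - β n * p.2) * g p))) μ := by
    refine (hexp (C + |β n|)).mono' (by fun_prop) (.of_forall fun p => ?_)
    rw [norm_mul, norm_mul, norm_mul, hnorm, one_mul, Complex.norm_real, Complex.norm_real,
      Real.norm_eq_abs, Real.norm_eq_abs, Real.abs_exp, Real.abs_exp, ← mul_assoc, ← Real.exp_add]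
    gcongr
    have := neg_abs_le (β n * p.2)
    rw [abs_mul] at this
    linarith
  have hlap (n : ℤ) (t : ℝ) : ∫ p : ℝ × ℝ, Complex.exp (t * p.2 * I) *
      (Complex.exp (-(2 * Real.pi * I * n * p.1)) * (Real.exp (-ν * p.2 ^ 2) * g p)) ∂μ = 0 := by
    rw [← integral_cexp_mul_eq_zero_of_moments_eq_zero measurable_snd (hF n)
      (moments_eq_zero_of_integral_physHermite_eq_zero measurable_snd (hF n) ha
        fun m => h0 m n) (β n + t * I)]
    refine integral_congr_ae (.of_forall fun p => ?_)
    have : Complex.exp ((β n + t * I) * p.2) * Real.exp (-ν * p.2 ^ 2 - β n * p.2) =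
        Complex.exp (t * p.2 * I) * Real.exp (-ν * p.2 ^ 2) := by
      push_cast
      rw [← Complex.exp_add, ← Complex.exp_add]
      ring_nf
    linear_combination -(Complex.exp (-(2 * Real.pi * I * n * p.1)) * g p) * this
  have hint (n : ℤ) : Integrable (fun p : ℝ × ℝ =>
      Complex.exp (-(2 * Real.pi * I * n * p.1)) * (Real.exp (-ν * p.2 ^ 2) * g p)) μ := by
    refine (hexp 0).mono' (by fun_prop) (.of_forall fun p => ?_)
    rw [norm_mul, norm_mul, hnorm, one_mul, Complex.norm_real, Real.norm_eq_abs, Real.abs_exp]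
    simp
  have hcoeff : ∀ᵐ y : ℝ, ∀ n : ℤ, ∫ x : ℝ in Set.Ioc 0 1,
      Complex.exp (-(2 * Real.pi * I * n * x)) * (Real.exp (-ν * y ^ 2) * g (x, y)) = 0 := by
    rw [ae_all_iff]
    intro n
    refine ae_eq_zero_of_integral_exp_mul_eq_zero (hint n).integral_prod_right fun t => ?_
    have hint' : Integrable (fun p : ℝ × ℝ => Complex.exp (t * p.2 * I) *
        (Complex.exp (-(2 * Real.pi * I * n * p.1)) * (Real.exp (-ν * p.2 ^ 2) * g p))) μ := by
      refine (hint n).norm.mono' (by fun_prop) (.of_forall fun p => ?_)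
      rw [norm_mul, ← Complex.ofReal_mul, Complex.norm_exp_ofReal_mul_I, one_mul]
    rw [← hlap n t, hμ, integral_prod_symm _ hint']
    simp only [integral_const_mul]
  have hL2 : ∀ᵐ y : ℝ, MemLp (fun x => g (x, y)) 2 (volume.restrict (Set.Ioc 0 1)) := by
    filter_upwards [((memLp_two_iff_integrable_sq_norm hg2.1).1 hg2).prod_left_ae] with y hy
    exact (memLp_two_iff_integrable_sq_norm
      (hg.comp (by fun_prop)).aestronglyMeasurable).2 hy
  have hae : ∀ᵐ y : ℝ, ∀ᵐ x ∂volume.restrict (Set.Ioc (0 : ℝ) 1), g (x, y) = 0 := by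
    filter_upwards [hcoeff, hL2] with y hy hy2
    filter_upwards [ae_eq_zero_of_forall_fourier_integral_eq_zero (hy2.const_mul _) hy] with x hx
    simpa using hx
  have hset : MeasurableSet {p : ℝ × ℝ | g p = 0} := hg (measurableSet_singleton 0)
  rw [hμ, Measure.ae_prod_iff_ae_ae hset]
  exact (Measure.ae_ae_comm hset).2 hae

/-- Integration over the strip `0 ≤ Re z ≤ 1` in real coordinates. -/
theorem measurePreserving_equivRealProd_symm_strip :
    MeasurePreserving Complex.measurableEquivRealProd.symm
      ((volume.restrict (Set.Ioc 0 1)).prod volume)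
      (volume.restrict {z : ℂ | z.re ∈ Set.Icc (0 : ℝ) 1}) := by
  have h := Complex.volume_preserving_equiv_real_prod.symm.restrict_preimage_emb
    Complex.measurableEquivRealProd.symm.measurableEmbedding {z : ℂ | z.re ∈ Set.Icc (0 : ℝ) 1}
  have hs : Complex.measurableEquivRealProd.symm ⁻¹' {z : ℂ | z.re ∈ Set.Icc (0 : ℝ) 1} =
      Set.Icc 0 1 ×ˢ Set.univ := by
    ext p
    simp [Complex.measurableEquivRealProd_symm_apply]
  rwa [hs, Measure.volume_eq_prod, ← Measure.prod_restrict, Measure.restrict_univ,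
    ← Measure.restrict_congr_set Ioc_ae_eq_Icc] at h

theorem ae_eq_zero_of_ae_strip_eq_zero {f : ℂ → ℂ} {c : ℤ → ℂ → ℂ}
    (hqp : ∀ m : ℤ, ∀ᵐ z : ℂ, f (z + m) = c m z * f z)
    (hstrip : ∀ᵐ z ∂volume.restrict {z : ℂ | z.re ∈ Set.Icc (0 : ℝ) 1}, f z = 0) :
    ∀ᵐ z : ℂ, f z = 0 := by
  have hS : MeasurableSet {z : ℂ | z.re ∈ Set.Icc (0 : ℝ) 1} :=
    Complex.measurable_re measurableSet_Icc
  rw [ae_restrict_iff' hS] at hstrip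
  have hall : ∀ᵐ z : ℂ, ∀ m : ℤ, z.re ∈ Set.Icc (0 : ℝ) 1 → f (z + m) = 0 := by
    rw [ae_all_iff]
    intro m
    filter_upwards [hqp m, hstrip] with z hz hz' hmem
    rw [hz, hz' hmem, mul_zero]
  have hshift : ∀ᵐ z : ℂ, ∀ k m : ℤ,
      (z - k).re ∈ Set.Icc (0 : ℝ) 1 → f (z - k + m) = 0 := by
    rw [ae_all_iff]
    intro k
    exact (measurePreserving_sub_right volume (k : ℂ)).quasiMeasurePreserving.ae hall
  filter_upwards [hshift] with z hz
  have := hz ⌊z.re⌋ ⌊z.re⌋ (by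
    simp only [Complex.sub_re, Complex.intCast_re]
    exact ⟨Int.fract_nonneg z.re, (Int.fract_lt_one z.re).le⟩)
  simpa using this

/-- Completeness of the orthonormal system `(ψ_{m,n})_{m≥0, n∈ℤ}`: any
measurable, a.e. quasi-periodic `f` with finite weighted `L²` norm on the strip `S`
that is orthogonal to every `ψ_{m,n}` vanishes almost everywhere. -/
theorem stmt_17 (α ν : ℝ) (hν : 0 < ν) (f : ℂ → ℂ) (hmeas : Measurable f)
    (hqp : ∀ m : ℤ, ∀ᵐ z : ℂ, f (z + m) =
        Complex.exp (2 * Real.pi * Complex.I * α * m) *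
          Complex.exp (ν * (z + m / 2) * m) * f z)
    (hfin : (∫⁻ z in {z : ℂ | z.re ∈ Set.Icc (0 : ℝ) 1},
        (‖f z‖₊ : ℝ≥0∞) ^ 2 * ENNReal.ofReal (Real.exp (-ν * Complex.normSq z))) ≠ ⊤)
    (horth : ∀ (m : ℕ) (n : ℤ),
      (∫ z in {z : ℂ | z.re ∈ Set.Icc (0 : ℝ) 1},
        f z * (starRingEnd ℂ) (psiMN α ν m n z) * Real.exp (-ν * Complex.normSq z)) = 0) :
    ∀ᵐ z : ℂ, f z = 0 := by
  have hT := measurePreserving_equivRealProd_symm_strip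
  have hTm := Complex.measurableEquivRealProd.symm.measurableEmbedding
  refine ae_eq_zero_of_ae_strip_eq_zero hqp ?_
  set g : ℝ × ℝ → ℂ := fun p =>
    Complex.exp (-(ν / 2 * p.1 ^ 2 + ν / 2 * p.2 ^ 2) -
      (ν * p.1 * p.2 + 2 * Real.pi * α * p.1) * I) * f (p.1 + p.2 * I) with hg_def
  have hg : Measurable g := by fun_prop
  have hT_apply (p : ℝ × ℝ) : Complex.measurableEquivRealProd.symm p = p.1 + p.2 * I := by
    rw [Complex.measurableEquivRealProd_symm_apply]
    exact Complex.mk_eq_add_mul_I _ _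
  have hsq (p : ℝ × ℝ) : Complex.normSq (p.1 + p.2 * I) = p.1 ^ 2 + p.2 ^ 2 :=
    Complex.normSq_add_mul_I _ _
  have hg2 : MemLp g 2 ((volume.restrict (Set.Ioc 0 1)).prod volume) := by
    refine ⟨hg.aestronglyMeasurable, ?_⟩
    rw [eLpNorm_lt_top_iff_lintegral_rpow_enorm_lt_top (by norm_num) (by norm_num)]
    rw [← hT.lintegral_comp_emb hTm] at hfin
    refine lt_of_eq_of_lt (lintegral_congr fun p => ?_) (lt_top_iff_ne_top.2 hfin)
    have hexp : ‖Complex.exp (-(ν / 2 * p.1 ^ 2 + ν / 2 * p.2 ^ 2) -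
        (ν * p.1 * p.2 + 2 * Real.pi * α * p.1) * I)‖ₑ ^ 2 =
        ENNReal.ofReal (Real.exp (-ν * (p.1 ^ 2 + p.2 ^ 2))) := by
      rw [← ofReal_norm, ← ENNReal.ofReal_pow (norm_nonneg _), Complex.norm_exp,
        ← Real.exp_nat_mul]
      congr 2
      simp [← Complex.ofReal_pow]
      ring
    rw [hT_apply, hsq, ← hexp, hg_def]
    simp only [enorm_mul, ENNReal.toReal_ofNat, ENNReal.rpow_ofNat, mul_pow]
    rw [mul_comm]
    rfl
  have hgz := ae_eq_zero_of_integral_strip_eq_zero hν hg hg2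
    (a := Real.sqrt (2 * ν)) (by positivity)
    (b := fun n => Real.sqrt (2 / ν) * Real.pi * (n + α))
    (β := fun n => 2 * Real.pi * (α + n)) ?_
  · rw [← hT.map_eq, hTm.ae_map_iff]
    filter_upwards [hgz] with p hp
    rw [hT_apply]
    simpa [hg_def, Complex.exp_ne_zero] using hp
  · intro m n
    have h := horth m n
    rw [← hT.integral_comp hTm] at h
    set A : ℝ := ((2 : ℝ) ^ m * Nat.factorial m) ^ (-(1 : ℝ) / 2) *
      (2 * ν / Real.pi) ^ ((1 : ℝ) / 4) *
      Real.exp (-(Real.pi ^ 2 / ν) * (n + α) ^ 2) with hA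
    have hA0 : (A : ℂ) ≠ 0 := by
      rw [Complex.ofReal_ne_zero]
      positivity
    refine (mul_eq_zero.1 (Eq.trans ?_ h)).resolve_left hA0
    rw [← integral_const_mul]
    refine integral_congr_ae (.of_forall fun p => ?_)
    have hexp : Complex.exp (-(2 * Real.pi * I * n * p.1)) *
        (Real.exp (-ν * p.2 ^ 2 - 2 * Real.pi * (α + n) * p.2) *
          Complex.exp (-(ν / 2 * p.1 ^ 2 + ν / 2 * p.2 ^ 2) -
            (ν * p.1 * p.2 + 2 * Real.pi * α * p.1) * I)) =
        (starRingEnd ℂ) (Complex.exp (ν / 2 * (p.1 + p.2 * I) ^ 2 +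
          2 * Real.pi * I * (α + n) * (p.1 + p.2 * I))) *
        Real.exp (-ν * (p.1 ^ 2 + p.2 ^ 2)) := by
      rw [← Complex.exp_conj]
      push_cast
      rw [← Complex.exp_add, ← Complex.exp_add, ← Complex.exp_add]
      congr 1
      simp only [map_add, map_mul, map_pow, map_div₀, Complex.conj_ofReal, Complex.conj_I,
        map_ofNat, map_intCast]
      linear_combination (-(ν / 2 * p.2 ^ 2) - 2 * Real.pi * (α + n) * p.2 : ℂ) * Complex.I_sq
    have him : ((p.1 : ℂ) + p.2 * I).im = p.2 := by simp
    simp only [hT_apply, hsq, psiMN, ← hA, map_mul, Complex.conj_ofReal, him, hg_def]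
    linear_combination (A * (((physHermite m).eval (Real.sqrt (2 * ν) * p.2 +
      Real.sqrt (2 / ν) * Real.pi * (n + α)) : ℝ) : ℂ) * f (p.1 + p.2 * I)) * hexp
end
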